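/- Let P ⊆ ℝ^d be a d-dimensional F-hollow lattice polytope with minimal multiplier μ := μ(P), and suppose the dimension k of the affine span of F(μP) satisfies 1 ≤ k ≤ d−1. Then there exists an affine map π : ℝ^d → ℝ^{d−k} with π(ℤ^d) = ℤ^{d−k} such that P' := π(P) is a (d−k)-dimensional F-hollow lattice polytope, F(μP') is a single point, and μ(P') = μ(P); in particular P' is weakly sporadic and P is not sporadic. -/

import Mathlib

open Set MeasureTheory

noncomputable section

/-- The real vector corresponding to an integer vector. -/
def intVec {d : ℕ} (ν : Fin d → ℤ) : Fin d → ℝ := fun i => (ν i : ℝ)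

/-- The standard inner product on `ℝ^d`. -/
def dotR {d : ℕ} (x y : Fin d → ℝ) : ℝ := ∑ i, x i * y i

/-- `Min_P(ν) = min_{x ∈ P} ⟨x, ν⟩`. -/
def MinP {d : ℕ} (P : Set (Fin d → ℝ)) (ν : Fin d → ℝ) : ℝ :=
  sInf ((fun x => dotR x ν) '' P)

/-- The set of lattice points of `ℝ^d`. -/
def latticePts (d : ℕ) : Set (Fin d → ℝ) := Set.range intVec

/-- The set of rational points of `ℝ^d`. -/
def ratPts (d : ℕ) : Set (Fin d → ℝ) := {x | ∀ i, ∃ q : ℚ, x i = (q : ℝ)}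

/-- The Fine interior of `P`. -/
def fineInt {d : ℕ} (P : Set (Fin d → ℝ)) : Set (Fin d → ℝ) :=
  {x | ∀ ν : Fin d → ℤ, ν ≠ 0 → MinP P (intVec ν) + 1 ≤ dotR x (intVec ν)}

/-- A lattice polytope: the convex hull of a finite set of lattice points. -/
def IsLatticePolytope {d : ℕ} (P : Set (Fin d → ℝ)) : Prop :=
  ∃ A : Finset (Fin d → ℝ), ↑A ⊆ latticePts d ∧ P = convexHull ℝ (A : Set (Fin d → ℝ))

/-- A rational polytope: the convex hull of a finite set of rational points. -/
def IsRatPolytope {d : ℕ} (P : Set (Fin d → ℝ)) : Prop :=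
  ∃ A : Finset (Fin d → ℝ), ↑A ⊆ ratPts d ∧ P = convexHull ℝ (A : Set (Fin d → ℝ))

/-- A subset of `ℝ^d` is full-dimensional if its affine span is everything. -/
def IsFullDim {d : ℕ} (P : Set (Fin d → ℝ)) : Prop := affineSpan ℝ P = ⊤

/-- `P` is F-hollow if its Fine interior is empty. -/
def FHollow {d : ℕ} (P : Set (Fin d → ℝ)) : Prop := fineInt P = ∅

/-- The dilation `λP = {λx : x ∈ P}`. -/
def dilate {d : ℕ} (lam : ℝ) (P : Set (Fin d → ℝ)) : Set (Fin d → ℝ) :=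
  (fun x => lam • x) '' P

/-- The minimal multiplier `μ(P)`. -/
def minMult {d : ℕ} (P : Set (Fin d → ℝ)) : ℝ :=
  sInf {lam : ℝ | 0 < lam ∧ (fineInt (dilate lam P)).Nonempty}

/-- Unimodular equivalence of subsets of `ℝ^d`. -/
def UnimodEquiv {d : ℕ} (P₁ P₂ : Set (Fin d → ℝ)) : Prop :=
  ∃ φ : (Fin d → ℝ) ≃ᵃ[ℝ] (Fin d → ℝ),
    φ '' latticePts d = latticePts d ∧ φ '' P₁ = P₂

/-- An affine map `ℝ^d → ℝ^k` inducing a surjection of lattices. -/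
def IsLatticeProj {d k : ℕ} (π : (Fin d → ℝ) →ᵃ[ℝ] (Fin k → ℝ)) : Prop :=
  π '' latticePts d = latticePts k

/-- A sporadic F-hollow lattice polytope: a full-dimensional F-hollow lattice
polytope admitting no lattice projection onto a lower-dimensional F-hollow
lattice polytope. -/
def IsSporadic {d : ℕ} (P : Set (Fin d → ℝ)) : Prop :=
  IsLatticePolytope P ∧ IsFullDim P ∧ FHollow P ∧
  ¬ ∃ (k : ℕ) (_ : 1 ≤ k) (_ : k ≤ d - 1) (π : (Fin d → ℝ) →ᵃ[ℝ] (Fin k → ℝ)),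
      IsLatticeProj π ∧ IsLatticePolytope (π '' P) ∧ IsFullDim (π '' P) ∧
      FHollow (π '' P)

/-- A weakly sporadic F-hollow lattice polytope: a full-dimensional F-hollow
lattice polytope `P` such that `F(μ(P)·P)` is a single point. -/
def IsWeaklySporadic {d : ℕ} (P : Set (Fin d → ℝ)) : Prop :=
  IsLatticePolytope P ∧ IsFullDim P ∧ FHollow P ∧
  ∃ p : Fin d → ℝ, fineInt (dilate (minMult P) P) = {p}

/-- The support `S_F(P)` of the Fine interior of `P`. -/
def suppF {d : ℕ} (P : Set (Fin d → ℝ)) : Set (Fin d → ℤ) :=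
  {ν | MinP (fineInt P) (intVec ν) = MinP P (intVec ν) + 1}

/-- The dimension of the affine span of a set. -/
def aDim {d : ℕ} (S : Set (Fin d → ℝ)) : ℕ :=
  Module.finrank ℝ (affineSpan ℝ S).direction

/-- Lebesgue volume of a subset of `ℝ^d`, as a real number. -/
def vol {d : ℕ} (S : Set (Fin d → ℝ)) : ℝ := (volume S).toReal

lemma abs_dotR_le {d : ℕ} (x u : Fin d → ℝ) : |dotR x u| ≤ d * ‖x‖ * ‖u‖ := by
  calc |dotR x u| ≤ ∑ i, |x i * u i| := Finset.abs_sum_le_sum_abs _ _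
    _ ≤ ∑ _i : Fin d, ‖x‖ * ‖u‖ := by
        refine Finset.sum_le_sum fun i _ => ?_
        rw [abs_mul]
        exact mul_le_mul (norm_le_pi_norm x i) (norm_le_pi_norm u i) (abs_nonneg _)
          (norm_nonneg _)
    _ = d * ‖x‖ * ‖u‖ := by simp [mul_assoc]

lemma dotR_add_left {d : ℕ} (x y u : Fin d → ℝ) : dotR (x + y) u = dotR x u + dotR y u :=
  add_dotProduct x y u

lemma dotR_sub_left {d : ℕ} (x y u : Fin d → ℝ) : dotR (x - y) u = dotR x u - dotR y u :=
  sub_dotProduct x y u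

lemma dotR_smul_left {d : ℕ} (t : ℝ) (x u : Fin d → ℝ) : dotR (t • x) u = t * dotR x u :=
  smul_dotProduct t x u

lemma dotR_add_right {d : ℕ} (x u v : Fin d → ℝ) : dotR x (u + v) = dotR x u + dotR x v :=
  dotProduct_add x u v

lemma dotR_smul_right {d : ℕ} (t : ℝ) (x u : Fin d → ℝ) : dotR x (t • u) = t * dotR x u :=
  dotProduct_smul t x u

lemma norm_intVec {d : ℕ} (ν : Fin d → ℤ) : ‖intVec ν‖ = ‖ν‖ := by
  simp [Pi.norm_def, intVec, nnnorm, Int.norm_eq_abs]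

section MinP

variable {d : ℕ} {P : Set (Fin d → ℝ)}

lemma bddBelow_dotR_image (hP : Bornology.IsBounded P) (u : Fin d → ℝ) :
    BddBelow ((fun x => dotR x u) '' P) := by
  obtain ⟨C, hC⟩ := hP.exists_norm_le
  refine ⟨-(d * C * ‖u‖), ?_⟩
  rintro _ ⟨x, hx, rfl⟩
  refine (abs_le.1 ((abs_dotR_le x u).trans ?_)).1
  have := hC x hx
  gcongr

lemma MinP_le (hP : Bornology.IsBounded P) {p : Fin d → ℝ} (hp : p ∈ P) (u : Fin d → ℝ) :
    MinP P u ≤ dotR p u :=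
  csInf_le (bddBelow_dotR_image hP u) ⟨p, hp, rfl⟩

lemma le_MinP (hne : P.Nonempty) {u : Fin d → ℝ} {c : ℝ} (h : ∀ p ∈ P, c ≤ dotR p u) :
    c ≤ MinP P u :=
  le_csInf (hne.image _) (by rintro _ ⟨p, hp, rfl⟩; exact h p hp)

lemma exists_abs_MinP_le (hP : Bornology.IsBounded P) (hne : P.Nonempty) :
    ∃ C, 0 ≤ C ∧ ∀ u, |MinP P u| ≤ C * ‖u‖ := by
  obtain ⟨C, hC⟩ := hP.exists_norm_le
  obtain ⟨p, hp⟩ := hne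
  have hbound : ∀ x ∈ P, ∀ u, |dotR x u| ≤ d * C * ‖u‖ := fun x hx u =>
    (abs_dotR_le x u).trans (by have := hC x hx; gcongr)
  have hC0 : 0 ≤ C := (norm_nonneg p).trans (hC p hp)
  refine ⟨d * C, by positivity, fun u => abs_le.2 ⟨?_, ?_⟩⟩
  · exact le_MinP ⟨p, hp⟩ fun x hx => (abs_le.1 (hbound x hx u)).1
  · exact (MinP_le hP hp u).trans (abs_le.1 (hbound p hp u)).2

lemma MinP_add_le (hP : Bornology.IsBounded P) (hne : P.Nonempty) (u v : Fin d → ℝ) :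
    MinP P u + MinP P v ≤ MinP P (u + v) :=
  le_MinP hne fun p hp => by
    rw [dotR_add_right]
    exact add_le_add (MinP_le hP hp u) (MinP_le hP hp v)

lemma MinP_smul {t : ℝ} (ht : 0 ≤ t) (u : Fin d → ℝ) : MinP P (t • u) = t * MinP P u := by
  have := Real.sInf_smul_of_nonneg ht ((fun x => dotR x u) '' P)
  rw [smul_eq_mul] at this
  rw [MinP, MinP, ← this, ← Set.image_smul, Set.image_image]
  simp only [dotR_smul_right, smul_eq_mul]

lemma MinP_dilate {t : ℝ} (ht : 0 ≤ t) (u : Fin d → ℝ) :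
    MinP (dilate t P) u = t * MinP P u := by
  rw [← MinP_smul ht, MinP, MinP, dilate, Set.image_image]
  simp only [dotR_smul_left, dotR_smul_right]

lemma mem_fineInt_dilate {t : ℝ} (ht : 0 ≤ t) {x : Fin d → ℝ} :
    x ∈ fineInt (dilate t P) ↔
      ∀ ν : Fin d → ℤ, ν ≠ 0 → t * MinP P (intVec ν) + 1 ≤ dotR x (intVec ν) := by
  simp only [fineInt, mem_ofPred_eq, MinP_dilate ht]

lemma dilate_one : dilate 1 P = P := by simp [dilate]

lemma convex_fineInt : Convex ℝ (fineInt P) := by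
  intro x hx y hy a b ha hb hab ν hν
  rw [dotR_add_left, dotR_smul_left, dotR_smul_left]
  have h1 := mul_le_mul_of_nonneg_left (hx ν hν) ha
  have h2 := mul_le_mul_of_nonneg_left (hy ν hν) hb
  calc MinP P (intVec ν) + 1 = (a + b) * (MinP P (intVec ν) + 1) := by rw [hab, one_mul]
    _ ≤ _ := by linarith

lemma fineInt_dilate_nonempty_mono (hP : Bornology.IsBounded P) (hne : P.Nonempty) {s t : ℝ}
    (hs : 0 ≤ s) (hst : s ≤ t) (h : (fineInt (dilate s P)).Nonempty) :
    (fineInt (dilate t P)).Nonempty := by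
  obtain ⟨x, hx⟩ := h
  obtain ⟨p, hp⟩ := hne
  refine ⟨x + (t - s) • p, (mem_fineInt_dilate (hs.trans hst)).2 fun ν hν => ?_⟩
  rw [dotR_add_left, dotR_smul_left]
  have h1 := (mem_fineInt_dilate hs).1 hx ν hν
  have h2 := mul_le_mul_of_nonneg_left (MinP_le hP hp (intVec ν)) (sub_nonneg.2 hst)
  linarith

end MinP

/-- Simultaneous Diophantine approximation, without a rate. -/
lemma exists_nat_smul_near_intVec {d : ℕ} (u : Fin d → ℝ) {ε : ℝ} (hε : 0 < ε) :
    ∃ q : ℕ, 1 ≤ q ∧ ∃ ν : Fin d → ℤ, ‖(q : ℝ) • u - intVec ν‖ < ε := by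
  let a : ℕ → Fin d → ℝ := fun n i => Int.fract (n * u i)
  have ha : ∀ n, a n ∈ Set.Icc (0 : Fin d → ℝ) 1 := fun n =>
    ⟨fun i => Int.fract_nonneg _, fun i => (Int.fract_lt_one _).le⟩
  obtain ⟨_, -, φ, hφ, hlim⟩ := isCompact_Icc.tendsto_subseq ha
  obtain ⟨N, hN⟩ := Metric.cauchySeq_iff.1 hlim.cauchySeq ε hε
  have hlt : φ N < φ (N + 1) := hφ N.lt_succ_self
  refine ⟨φ (N + 1) - φ N, by omega,
    fun i => ⌊(φ (N + 1) : ℝ) * u i⌋ - ⌊(φ N : ℝ) * u i⌋, ?_⟩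
  have hd := hN (N + 1) N.le_succ N le_rfl
  rw [dist_eq_norm] at hd
  refine lt_of_eq_of_lt (congrArg norm ?_) hd
  ext i
  simp only [Pi.sub_apply, Pi.smul_apply, smul_eq_mul, intVec, Function.comp_apply, a,
    Int.fract, Nat.cast_sub hlt.le, Int.cast_sub]
  ring

section Perturbation

variable {d : ℕ} {P : Set (Fin d → ℝ)}

/-- Points of the Fine interior have distance to the supporting hyperplanes that is bounded
below linearly in the normal vector. -/
lemma exists_pos_mul_norm_le_gap (hP : Bornology.IsBounded P) (hne : P.Nonempty) {μ : ℝ}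
    (hμ : 0 ≤ μ) {x₀ : Fin d → ℝ} (hx₀ : x₀ ∈ fineInt (dilate μ P)) :
    ∃ r, 0 < r ∧ ∀ u, r * ‖u‖ ≤ dotR x₀ u - μ * MinP P u := by
  rw [mem_fineInt_dilate hμ] at hx₀
  obtain ⟨C, hC0, hC⟩ := exists_abs_MinP_le hP hne
  set h : (Fin d → ℝ) → ℝ := fun u => dotR x₀ u - μ * MinP P u with hh
  set K : ℝ := d * ‖x₀‖ + μ * C with hK
  have hK0 : 0 ≤ K := by positivity
  have hle : ∀ u, h u ≤ K * ‖u‖ := fun u => by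
    have h1 := (abs_le.1 (abs_dotR_le x₀ u)).2
    have h2 := mul_le_mul_of_nonneg_left (abs_le.1 (hC u)).1 hμ
    simp only [hh, hK]
    linarith
  have hadd : ∀ u v, h (u + v) ≤ h u + h v := fun u v => by
    have h1 := mul_le_mul_of_nonneg_left (MinP_add_le hP hne u v) hμ
    simp only [hh, dotR_add_right]
    linarith
  have hsmul : ∀ (t : ℝ), 0 ≤ t → ∀ u, h (t • u) = t * h u := fun t ht u => by
    simp only [hh, dotR_smul_right, MinP_smul ht]
    ring
  have hcont : Continuous h := by
    refine (LipschitzWith.of_le_add_mul K.toNNReal fun u v => ?_).continuous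
    have h1 := hadd v (u - v)
    have h2 := hle (u - v)
    rw [add_sub_cancel] at h1
    rw [dist_eq_norm, Real.coe_toNNReal K hK0]
    linarith
  have hpos : ∀ u, u ≠ 0 → 0 < h u := by
    intro u hu
    by_contra! hneg
    have hun : 0 < ‖u‖ := norm_pos_iff.2 hu
    obtain ⟨q, hq, ν, hν⟩ := exists_nat_smul_near_intVec u
      (ε := min ‖u‖ (1 / (K + 1))) (by positivity)
    have hq' : (1 : ℝ) ≤ q := by exact_mod_cast hq
    have hν0 : ν ≠ 0 := by
      rintro rfl
      have h0 : intVec (0 : Fin d → ℤ) = 0 := by ext; simp [intVec]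
      rw [h0, sub_zero, norm_smul, Real.norm_natCast] at hν
      have := hν.trans_le (min_le_left _ _)
      nlinarith
    have h1 := hx₀ ν hν0
    have h2 := hadd ((q : ℝ) • u) (intVec ν - (q : ℝ) • u)
    rw [add_sub_cancel, hsmul _ (by positivity)] at h2
    have h3 := hle (intVec ν - (q : ℝ) • u)
    rw [norm_sub_rev] at h3
    have h4 : ‖(q : ℝ) • u - intVec ν‖ < 1 / (K + 1) := hν.trans_le (min_le_right _ _)
    have h5 : K * ‖(q : ℝ) • u - intVec ν‖ < 1 := by
      rw [lt_div_iff₀ (by positivity)] at h4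
      nlinarith [norm_nonneg ((q : ℝ) • u - intVec ν)]
    have h6 : (q : ℝ) * h u ≤ 0 := mul_nonpos_of_nonneg_of_nonpos (by positivity) hneg
    have h7 : 1 ≤ h (intVec ν) := by simp only [hh]; linarith
    linarith
  have h0 : h 0 = 0 := by simpa using hsmul 0 le_rfl 0
  rcases (Metric.sphere (0 : Fin d → ℝ) 1).eq_empty_or_nonempty with he | hsn
  · refine ⟨1, one_pos, fun u => ?_⟩
    have hu : u = 0 := by
      by_contra hu
      have : ‖u‖⁻¹ • u ∈ Metric.sphere (0 : Fin d → ℝ) 1 := by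
        rw [mem_sphere_zero_iff_norm, norm_smul, norm_inv, norm_norm,
          inv_mul_cancel₀ (norm_ne_zero_iff.2 hu)]
      rw [he] at this
      exact this
    change _ ≤ h u
    rw [hu, h0]
    simp
  · obtain ⟨w, hw, hmin⟩ := (isCompact_sphere (0 : Fin d → ℝ) 1).exists_isMinOn hsn
      hcont.continuousOn
    rw [mem_sphere_zero_iff_norm] at hw
    refine ⟨h w, hpos w (norm_ne_zero_iff.1 (by rw [hw]; exact one_ne_zero)), fun u => ?_⟩
    change _ ≤ h u
    rcases eq_or_ne u 0 with rfl | hu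
    · simp [h0]
    have hun : 0 < ‖u‖ := norm_pos_iff.2 hu
    have h1 : h w ≤ h (‖u‖⁻¹ • u) := hmin (by
      rw [mem_sphere_zero_iff_norm, norm_smul, norm_inv, norm_norm, inv_mul_cancel₀ hun.ne'])
    rw [hsmul _ (by positivity), inv_mul_eq_div, le_div_iff₀ hun] at h1
    exact h1

/-- A point satisfying the constraints of `F(λP)` that are active at `x₀ ∈ F(μP)` can be reached
from `x₀` by a short segment along which all constraints hold, for the interpolated dilates. -/
lemma exists_segment_mem_fineInt (hP : Bornology.IsBounded P) (hne : P.Nonempty) {μ lam : ℝ}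
    (hμ : 0 ≤ μ) (hlam : 0 ≤ lam) {x₀ y : Fin d → ℝ} (hx₀ : x₀ ∈ fineInt (dilate μ P))
    (hy : ∀ ν : Fin d → ℤ, ν ≠ 0 → dotR x₀ (intVec ν) = μ * MinP P (intVec ν) + 1 →
      lam * MinP P (intVec ν) + 1 ≤ dotR y (intVec ν)) :
    ∃ t, 0 < t ∧ t ≤ 1 ∧ x₀ + t • (y - x₀) ∈ fineInt (dilate (μ + t * (lam - μ)) P) := by
  obtain ⟨r, hr, hgap⟩ := exists_pos_mul_norm_le_gap hP hne hμ hx₀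
  obtain ⟨C, hC0, hC⟩ := exists_abs_MinP_le hP hne
  have hx := (mem_fineInt_dilate hμ).1 hx₀
  set K : ℝ := d * ‖y‖ + lam * C with hK
  have hK0 : 0 ≤ K := by positivity
  have hg : ∀ u, -(K * ‖u‖) ≤ dotR y u - lam * MinP P u := fun u => by
    have h1 := (abs_le.1 (abs_dotR_le y u)).1
    have h2 := mul_le_mul_of_nonneg_left (abs_le.1 (hC u)).2 hlam
    rw [hK]
    linarith
  have hfin : (Metric.closedBall (0 : Fin d → ℤ) (2 / r)).Finite :=
    (isCompact_closedBall _ _).finite_of_discrete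
  have hnear : ∀ᶠ t in nhdsWithin (0 : ℝ) (Set.Ioi 0),
      ∀ ν ∈ Metric.closedBall (0 : Fin d → ℤ) (2 / r), ν ≠ 0 →
      1 ≤ (1 - t) * (dotR x₀ (intVec ν) - μ * MinP P (intVec ν)) +
        t * (dotR y (intVec ν) - lam * MinP P (intVec ν)) := by
    rw [Filter.eventually_all_finite hfin]
    intro ν _
    rcases eq_or_ne ν 0 with rfl | hν
    · exact Filter.Eventually.of_forall fun _ h => absurd rfl h
    rcases (hx ν hν).eq_or_lt with heq | hlt
    · have h1 := hy ν hν heq.symm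
      filter_upwards [Ioo_mem_nhdsGT (zero_lt_one (α := ℝ))] with t ht _
      have h2 : dotR x₀ (intVec ν) - μ * MinP P (intVec ν) = 1 := by linarith
      have h3 : 1 ≤ dotR y (intVec ν) - lam * MinP P (intVec ν) := by linarith
      rw [h2]
      nlinarith [ht.1]
    · have hc : Continuous fun t : ℝ =>
          (1 - t) * (dotR x₀ (intVec ν) - μ * MinP P (intVec ν)) +
          t * (dotR y (intVec ν) - lam * MinP P (intVec ν)) := by fun_prop
      have hev := (hc.tendsto 0).eventually_const_lt (u := 1) (by
        simp only [sub_zero, one_mul, zero_mul, add_zero]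
        linarith)
      exact (hev.filter_mono nhdsWithin_le_nhds).mono fun t ht _ => ht.le
  have hsmall : Set.Ioo (0 : ℝ) (min 1 (r / 2 / (r + K))) ∈ nhdsWithin (0 : ℝ) (Set.Ioi 0) :=
    Ioo_mem_nhdsGT (by positivity)
  obtain ⟨t, ht, ht0, ht1⟩ := (hnear.and hsmall).exists
  have ht1' : t < 1 := ht1.trans_le (min_le_left _ _)
  have ht2 : t * (r + K) < r / 2 := by
    have := ht1.trans_le (min_le_right _ _)
    rwa [lt_div_iff₀ (by positivity)] at this
  refine ⟨t, ht0, ht1'.le, (mem_fineInt_dilate (by nlinarith)).2 fun ν hν => ?_⟩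
  rw [dotR_add_left, dotR_smul_left, dotR_sub_left]
  suffices 1 ≤ (1 - t) * (dotR x₀ (intVec ν) - μ * MinP P (intVec ν)) +
      t * (dotR y (intVec ν) - lam * MinP P (intVec ν)) by linarith
  by_cases hB : ν ∈ Metric.closedBall (0 : Fin d → ℤ) (2 / r)
  · exact ht ν hB hν
  rw [mem_closedBall_zero_iff, not_le, ← norm_intVec, div_lt_iff₀ hr] at hB
  have h1 := mul_le_mul_of_nonneg_left (hgap (intVec ν)) (sub_nonneg.2 ht1'.le)
  have h2 := mul_le_mul_of_nonneg_left (hg (intVec ν)) ht0.le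
  have h3 := mul_le_mul_of_nonneg_right ht2.le (norm_nonneg (intVec ν))
  linarith

end Perturbation

/-- A nonempty convex set has a point through which every segment of the set can be extended. -/
lemma exists_mem_forall_extend {d : ℕ} {F : Set (Fin d → ℝ)} (hF : Convex ℝ F)
    (hne : F.Nonempty) :
    ∃ x₀ ∈ F, ∀ x ∈ F, ∃ ε : ℝ, 0 < ε ∧ x₀ - ε • (x - x₀) ∈ F := by
  obtain ⟨x₀, hx₀⟩ := hne.intrinsicInterior hF
  refine ⟨x₀, intrinsicInterior_subset hx₀, fun x hx => ?_⟩
  obtain ⟨y, hy, rfl⟩ := mem_intrinsicInterior.1 hx₀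
  let z : affineSpan ℝ F := ⟨x, subset_affineSpan ℝ F hx⟩
  have hmem : ∀ t : ℝ, (y : Fin d → ℝ) - t • ((z : Fin d → ℝ) - y) ∈ affineSpan ℝ F := by
    intro t
    have := AffineMap.lineMap_mem (-t) y.2 z.2
    rw [AffineMap.lineMap_apply_module'] at this
    convert this using 1
    module
  let f : ℝ → affineSpan ℝ F := fun t => ⟨_, hmem t⟩
  have hf : Continuous f := by
    refine Continuous.subtype_mk ?_ _
    fun_prop
  have hf0 : f 0 = y := by
    ext1
    simp [f]
  have hev : ∀ᶠ t in nhds (0 : ℝ), f t ∈ interior ((↑) ⁻¹' F : Set (affineSpan ℝ F)) :=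
    hf.continuousAt.eventually_mem (by rw [hf0]; exact isOpen_interior.mem_nhds hy)
  obtain ⟨t, ht, ht0⟩ :=
    ((hev.filter_mono (nhdsWithin_le_nhds (s := Set.Ioi 0))).and self_mem_nhdsWithin).exists
  have hft : f t ∈ ((↑) ⁻¹' F : Set (affineSpan ℝ F)) := interior_subset ht
  exact ⟨t, ht0, hft⟩

/-- A saturated sublattice of `ℤ^d` is the row lattice of an integer matrix whose associated
linear map `ℤ^d → ℤ^n` is surjective. -/
lemma exists_matrix_of_saturated {d : ℕ} (N : Submodule ℤ (Fin d → ℤ))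
    (hN : ∀ (a : ℤ) (v : Fin d → ℤ), a ≠ 0 → a • v ∈ N → v ∈ N) :
    ∃ (n : ℕ) (b : Matrix (Fin n) (Fin d) ℤ),
      (∀ ν, ν ∈ N ↔ ∃ c, Matrix.vecMul c b = ν) ∧ Function.Surjective b.mulVec := by
  have : Module.IsTorsionFree ℤ ((Fin d → ℤ) ⧸ N) := by
    rw [Module.isTorsionFree_iff_smul_eq_zero]
    intro a q
    obtain ⟨v, rfl⟩ := N.mkQ_surjective q
    rw [← map_smul, Submodule.mkQ_apply, Submodule.mkQ_apply,
      Submodule.Quotient.mk_eq_zero, Submodule.Quotient.mk_eq_zero]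
    exact fun h => or_iff_not_imp_left.2 fun ha => hN a v ha h
  obtain ⟨s, hs⟩ := Module.projective_lifting_property N.mkQ LinearMap.id N.mkQ_surjective
  have hmem : ∀ v, v - s (N.mkQ v) ∈ N := fun v => by
    rw [← Submodule.Quotient.mk_eq_zero N, ← Submodule.mkQ_apply, map_sub, sub_eq_zero]
    exact (LinearMap.congr_fun hs (N.mkQ v)).symm
  let ρ : (Fin d → ℤ) →ₗ[ℤ] N := (LinearMap.id - s ∘ₗ N.mkQ).codRestrict N hmem
  have hρ : ∀ v : N, ρ v = v := fun v => by
    ext1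
    have : N.mkQ (v : Fin d → ℤ) = 0 := by simp
    change (v : Fin d → ℤ) - s (N.mkQ v) = v
    rw [this, map_zero, sub_zero]
  let B := Module.finBasis ℤ N
  refine ⟨_, Matrix.of fun i => (B i : Fin d → ℤ), fun ν => ⟨fun hν => ?_, ?_⟩, fun c => ?_⟩
  · refine ⟨B.repr ⟨ν, hν⟩, ?_⟩
    rw [Matrix.vecMul_eq_sum]
    have := congrArg N.subtype (B.sum_repr ⟨ν, hν⟩)
    rwa [map_sum] at this
  · rintro ⟨c, rfl⟩
    rw [Matrix.vecMul_eq_sum]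
    exact N.sum_mem fun i _ => N.smul_mem _ (B i).2
  · let f : (Fin d → ℤ) →ₗ[ℤ] ℤ := B.constr ℤ c ∘ₗ ρ
    refine ⟨fun j => f fun l => if j = l then 1 else 0, ?_⟩
    ext i
    have h1 : f (B i : Fin d → ℤ) = c i := by
      simp [f, hρ]
    rw [← h1, f.pi_apply_eq_sum_univ]
    rfl

section Projection

variable {d n : ℕ}

/-- The linear map `ℝ^d → ℝ^n` given by an integer matrix. -/
def intProj (b : Matrix (Fin n) (Fin d) ℤ) : (Fin d → ℝ) →ₗ[ℝ] (Fin n → ℝ) :=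
  (b.map (Int.cast : ℤ → ℝ)).mulVecLin

lemma intVec_vecMul (b : Matrix (Fin n) (Fin d) ℤ) (c : Fin n → ℤ) :
    intVec (Matrix.vecMul c b) = Matrix.vecMul (intVec c) (b.map (Int.cast : ℤ → ℝ)) :=
  funext fun i => RingHom.map_vecMul (Int.castRingHom ℝ) b c i

lemma intProj_intVec (b : Matrix (Fin n) (Fin d) ℤ) (x : Fin d → ℤ) :
    intProj b (intVec x) = intVec (b.mulVec x) :=
  funext fun i => (RingHom.map_mulVec (Int.castRingHom ℝ) b x i).symm

lemma dotR_intProj (b : Matrix (Fin n) (Fin d) ℤ) (x : Fin d → ℝ) (c : Fin n → ℤ) :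
    dotR (intProj b x) (intVec c) = dotR x (intVec (Matrix.vecMul c b)) := by
  rw [intVec_vecMul]
  change dotProduct (Matrix.mulVec _ x) (intVec c) = dotProduct x (Matrix.vecMul _ _)
  rw [dotProduct_comm, Matrix.dotProduct_mulVec, dotProduct_comm]

lemma MinP_image_intProj (b : Matrix (Fin n) (Fin d) ℤ) (P : Set (Fin d → ℝ))
    (c : Fin n → ℤ) :
    MinP (intProj b '' P) (intVec c) = MinP P (intVec (Matrix.vecMul c b)) := by
  simp only [MinP, Set.image_image, dotR_intProj]

lemma intProj_image_latticePts {b : Matrix (Fin n) (Fin d) ℤ}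
    (hb : Function.Surjective b.mulVec) : intProj b '' latticePts d = latticePts n := by
  ext y
  constructor
  · rintro ⟨_, ⟨x, rfl⟩, rfl⟩
    exact ⟨_, (intProj_intVec b x).symm⟩
  · rintro ⟨c, rfl⟩
    obtain ⟨x, rfl⟩ := hb c
    exact ⟨_, ⟨x, rfl⟩, intProj_intVec b x⟩

lemma vecMul_ne_zero {b : Matrix (Fin n) (Fin d) ℤ} (hb : Function.Surjective b.mulVec)
    {c : Fin n → ℤ} (hc : c ≠ 0) : Matrix.vecMul c b ≠ 0 := by
  contrapose! hc
  obtain ⟨x, hx⟩ := hb c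
  rw [← dotProduct_self_eq_zero]
  nth_rewrite 2 [← hx]
  rw [Matrix.dotProduct_mulVec, hc, zero_dotProduct]

lemma intProj_surjective {b : Matrix (Fin n) (Fin d) ℤ}
    (hb : Function.Surjective b.mulVec) : Function.Surjective (intProj b) := by
  choose x hx using fun i : Fin n => hb (Pi.single i 1)
  intro y
  refine ⟨∑ i, y i • intVec (x i), ?_⟩
  rw [map_sum]
  ext j
  simp only [map_smul, intProj_intVec, hx, Finset.sum_apply, Pi.smul_apply, smul_eq_mul, intVec]
  simp [Pi.single_apply]

lemma isLatticePolytope_image_intProj (b : Matrix (Fin n) (Fin d) ℤ) {P : Set (Fin d → ℝ)}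
    (hP : IsLatticePolytope P) : IsLatticePolytope (intProj b '' P) := by
  classical
  obtain ⟨A, hA, rfl⟩ := hP
  refine ⟨A.image (intProj b), ?_, ?_⟩
  · rw [Finset.coe_image]
    rintro _ ⟨a, ha, rfl⟩
    obtain ⟨x, rfl⟩ := hA ha
    exact ⟨_, (intProj_intVec b x).symm⟩
  · rw [Finset.coe_image, LinearMap.image_convexHull]

end Projection

section Hollow

variable {d : ℕ} {P : Set (Fin d → ℝ)}

lemma minMult_nonneg : 0 ≤ minMult P :=
  Real.sInf_nonneg fun _ h => h.1.le

lemma minMult_le {t : ℝ} (ht : 0 < t) (h : (fineInt (dilate t P)).Nonempty) : minMult P ≤ t :=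
  csInf_le ⟨0, fun _ h => h.1.le⟩ ⟨ht, h⟩

lemma one_lt_minMult (hP : Bornology.IsBounded P) (hP0 : P.Nonempty) (hhollow : FHollow P)
    (hne : (fineInt (dilate (minMult P) P)).Nonempty) : 1 < minMult P := by
  by_contra! h
  have := fineInt_dilate_nonempty_mono hP hP0 minMult_nonneg h hne
  rw [dilate_one, hhollow] at this
  exact Set.not_nonempty_empty this

/-- The direction of the affine span of `F(μP)` is cut out by the constraints active at a
relative interior point. -/
lemma mem_vectorSpan_fineInt_iff (hP : Bornology.IsBounded P) (hP0 : P.Nonempty) {μ : ℝ}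
    (hμ : 0 ≤ μ) {x₀ : Fin d → ℝ} (hx₀ : x₀ ∈ fineInt (dilate μ P))
    (hext : ∀ x ∈ fineInt (dilate μ P), ∃ ε : ℝ, 0 < ε ∧
      x₀ - ε • (x - x₀) ∈ fineInt (dilate μ P)) {v : Fin d → ℝ} :
    v ∈ vectorSpan ℝ (fineInt (dilate μ P)) ↔
      ∀ ν : Fin d → ℤ, ν ≠ 0 → dotR x₀ (intVec ν) = μ * MinP P (intVec ν) + 1 →
        dotR v (intVec ν) = 0 := by
  constructor
  · intro hv ν hν hact
    have hconst : ∀ x ∈ fineInt (dilate μ P), dotR (x - x₀) (intVec ν) = 0 := by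
      intro x hx
      obtain ⟨ε, hε, hmem⟩ := hext x hx
      have h1 := (mem_fineInt_dilate hμ).1 hx ν hν
      have h2 := (mem_fineInt_dilate hμ).1 hmem ν hν
      rw [dotR_sub_left, dotR_smul_left] at h2
      have h3 : ε * dotR (x - x₀) (intVec ν) ≤ 0 := by linarith
      refine le_antisymm (nonpos_of_mul_nonpos_right h3 hε) ?_
      rw [dotR_sub_left]
      linarith
    rw [vectorSpan_eq_span_vsub_set_right ℝ hx₀] at hv
    induction hv using Submodule.span_induction with
    | mem v hv =>
      obtain ⟨x, hx, rfl⟩ := hv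
      exact hconst x hx
    | zero => exact zero_dotProduct _
    | add v w _ _ hv hw => rw [dotR_add_left, hv, hw, add_zero]
    | smul a v _ hv => rw [dotR_smul_left, hv, mul_zero]
  · intro hv
    obtain ⟨t, ht0, -, ht⟩ := exists_segment_mem_fineInt hP hP0 hμ hμ hx₀ (y := x₀ + v)
      fun ν hν hact => by rw [dotR_add_left, hv ν hν hact, add_zero, hact]
    rw [sub_self, mul_zero, add_zero, add_sub_cancel_left] at ht
    have h1 := vsub_mem_vectorSpan ℝ ht hx₀
    rw [vsub_eq_sub, add_sub_cancel_left] at h1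
    simpa [smul_smul, inv_mul_cancel₀ ht0.ne'] using Submodule.smul_mem _ t⁻¹ h1

end Hollow

/-- There is a surjective integer matrix whose kernel is the direction of the affine span of
`F(μP)` and whose row lattice contains all normals active at some point of `F(μP)`. -/
lemma exists_matrix_ker_eq_vectorSpan_fineInt {d : ℕ} {P : Set (Fin d → ℝ)}
    (hP : Bornology.IsBounded P) (hP0 : P.Nonempty) {μ : ℝ} (hμ : 0 ≤ μ)
    (hne : (fineInt (dilate μ P)).Nonempty) :
    ∃ (n : ℕ) (b : Matrix (Fin n) (Fin d) ℤ), Function.Surjective b.mulVec ∧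
      LinearMap.ker (intProj b) = vectorSpan ℝ (fineInt (dilate μ P)) ∧
      ∃ x₀ ∈ fineInt (dilate μ P), ∀ ν : Fin d → ℤ, ν ≠ 0 →
        dotR x₀ (intVec ν) = μ * MinP P (intVec ν) + 1 → ∃ c, Matrix.vecMul c b = ν := by
  obtain ⟨x₀, hx₀, hext⟩ := exists_mem_forall_extend convex_fineInt hne
  have hW := fun v => mem_vectorSpan_fineInt_iff hP hP0 hμ hx₀ hext (v := v)
  set W := vectorSpan ℝ (fineInt (dilate μ P))
  let N : Submodule ℤ (Fin d → ℤ) :=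
    { carrier := {ν | ∀ w ∈ W, dotR w (intVec ν) = 0}
      zero_mem' := fun w _ => by simp [dotR, intVec]
      add_mem' := fun {ν ν'} h h' w hw => by
        have : intVec (ν + ν') = intVec ν + intVec ν' := by ext; simp [intVec]
        rw [this, dotR_add_right, h w hw, h' w hw, add_zero]
      smul_mem' := fun a ν h w hw => by
        have : intVec (a • ν) = (a : ℝ) • intVec ν := by ext; simp [intVec]
        rw [this, dotR_smul_right, h w hw, mul_zero] }
  have hN : ∀ (a : ℤ) (v : Fin d → ℤ), a ≠ 0 → a • v ∈ N → v ∈ N := by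
    intro a ν ha h w hw
    have h1 := h w hw
    have : intVec (a • ν) = (a : ℝ) • intVec ν := by ext; simp [intVec]
    rw [this, dotR_smul_right] at h1
    exact (mul_eq_zero.1 h1).resolve_left (by exact_mod_cast ha)
  obtain ⟨n, b, hb, hsurj⟩ := exists_matrix_of_saturated N hN
  have hact : ∀ ν : Fin d → ℤ, ν ≠ 0 →
      dotR x₀ (intVec ν) = μ * MinP P (intVec ν) + 1 → ∃ c, Matrix.vecMul c b = ν :=
    fun ν hν h => (hb ν).1 fun w hw => (hW w).1 hw ν hν h
  refine ⟨n, b, hsurj, ?_, x₀, hx₀, hact⟩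
  ext v
  rw [LinearMap.mem_ker]
  constructor
  · intro hv
    refine (hW v).2 fun ν hν h => ?_
    obtain ⟨c, rfl⟩ := hact ν hν h
    rw [← dotR_intProj, hv]
    exact zero_dotProduct _
  · intro hv
    ext i
    have h1 := (hb _).2 ⟨Pi.single i 1, rfl⟩ v hv
    rw [← dotR_intProj] at h1
    simpa [dotR, intVec, Pi.single_apply] using h1

/-- If `P` is a `d`-dimensional F-hollow lattice polytope with
`1 ≤ dim F(μP) ≤ d-1`, then `P` projects onto a `(d-k)`-dimensional weakly
sporadic F-hollow lattice polytope `P'` with the same minimal multiplier. -/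
theorem projection_to_weakly_sporadic (d : ℕ) (P : Set (Fin d → ℝ))
    (hP : IsLatticePolytope P) (hfull : IsFullDim P) (hhollow : FHollow P)
    (k : ℕ) (hne : (fineInt (dilate (minMult P) P)).Nonempty)
    (hk : aDim (fineInt (dilate (minMult P) P)) = k)
    (hk1 : 1 ≤ k) (hk2 : k ≤ d - 1) :
    ∃ π : (Fin d → ℝ) →ᵃ[ℝ] (Fin (d - k) → ℝ),
      IsLatticeProj π ∧
      IsLatticePolytope (π '' P) ∧ IsFullDim (π '' P) ∧ FHollow (π '' P) ∧
      (∃ p : Fin (d - k) → ℝ, fineInt (dilate (minMult P) (π '' P)) = {p}) ∧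
      minMult (π '' P) = minMult P := by
  have hPb : Bornology.IsBounded P := by
    obtain ⟨A, -, rfl⟩ := hP
    exact isBounded_convexHull.2 A.finite_toSet.isBounded
  have hP0 : P.Nonempty := by
    rw [← affineSpan_nonempty ℝ, hfull]
    exact ⟨0, trivial⟩
  have hμ1 := one_lt_minMult hPb hP0 hhollow hne
  have hμ0 : 0 ≤ minMult P := minMult_nonneg
  obtain ⟨n, b, hsurj, hker, x₀, hx₀, hact⟩ :=
    exists_matrix_ker_eq_vectorSpan_fineInt hPb hP0 hμ0 hne
  have hsurjR := intProj_surjective hsurj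
  obtain rfl : n = d - k := by
    have h := LinearMap.finrank_range_add_finrank_ker (intProj b)
    rw [LinearMap.range_eq_top.2 hsurjR, finrank_top, hker, ← direction_affineSpan] at h
    rw [aDim] at hk
    simp only [Module.finrank_fin_fun] at h
    omega
  have hmem : intProj b x₀ ∈ fineInt (dilate (minMult P) (intProj b '' P)) := by
    refine (mem_fineInt_dilate hμ0).2 fun c hc => ?_
    rw [MinP_image_intProj, dotR_intProj]
    exact (mem_fineInt_dilate hμ0).1 hx₀ _ (vecMul_ne_zero hsurj hc)
  have hlift : ∀ lam, 0 < lam → ∀ y, intProj b y ∈ fineInt (dilate lam (intProj b '' P)) →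
      ∃ t, 0 < t ∧ t ≤ 1 ∧
        x₀ + t • (y - x₀) ∈ fineInt (dilate (minMult P + t * (lam - minMult P)) P) := by
    intro lam hlam y hy
    refine exists_segment_mem_fineInt hPb hP0 hμ0 hlam.le hx₀ fun ν hν h => ?_
    obtain ⟨c, rfl⟩ := hact ν hν h
    rw [← MinP_image_intProj, ← dotR_intProj]
    refine (mem_fineInt_dilate hlam.le).1 hy c ?_
    rintro rfl
    exact hν (Matrix.zero_vecMul b)
  have hlower : ∀ lam, 0 < lam → (fineInt (dilate lam (intProj b '' P))).Nonempty →
      minMult P ≤ lam := by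
    rintro lam hlam ⟨z, hz⟩
    obtain ⟨y, rfl⟩ := hsurjR z
    obtain ⟨t, ht0, ht1, ht⟩ := hlift lam hlam y hz
    have h1 := minMult_le (by nlinarith) ⟨_, ht⟩
    nlinarith
  refine ⟨(intProj b).toAffineMap, intProj_image_latticePts hsurj,
    isLatticePolytope_image_intProj b hP, ?_, ?_, ⟨intProj b x₀, ?_⟩, ?_⟩
  · rw [IsFullDim, ← AffineSubspace.map_span, hfull]
    exact AffineMap.map_top_of_surjective _ hsurjR
  · rw [FHollow, Set.eq_empty_iff_forall_notMem]
    intro z hz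
    refine hμ1.not_ge (hlower 1 one_pos ⟨z, ?_⟩)
    rw [dilate_one]
    exact hz
  · refine Set.eq_singleton_iff_unique_mem.2 ⟨hmem, fun z hz => ?_⟩
    obtain ⟨y, rfl⟩ := hsurjR z
    obtain ⟨t, ht0, -, ht⟩ := hlift _ (by linarith) y hz
    rw [sub_self, mul_zero, add_zero] at ht
    have h1 := vsub_mem_vectorSpan ℝ ht hx₀
    rw [← hker, LinearMap.mem_ker, vsub_eq_sub, add_sub_cancel_left, map_smul, map_sub,
      smul_eq_zero_iff_right ht0.ne', sub_eq_zero] at h1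
    exact h1
  · exact IsLeast.csInf_eq ⟨⟨by linarith, _, hmem⟩, fun lam h => hlower lam h.1 h.2⟩
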